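/- The map x ↦ λ⁻¹τ(x)λ is a positive involution on the even Clifford algebra C⁺(V): the ℚ-bilinear form (x,y) ↦ tr(λ⁻¹·τ(x)·λ·y) on C⁺(V) is symmetric, i.e. tr(λ⁻¹τ(x)λy) = tr(λ⁻¹τ(y)λx) for all x, y ∈ C⁺(V), and positive definite, i.e. tr(λ⁻¹τ(x)λx) > 0 for every nonzero x ∈ C⁺(V). -/

import Mathlib

open CliffordAlgebra

set_option synthInstance.maxHeartbeats 1000000
set_option maxHeartbeats 2000000

noncomputable section

variable (n : ℕ) (a : Fin (n + 2) → ℚ)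

/-- The quadratic form `Q(x) = -a₁x₁² - a₂x₂² + a₃x₃² + ⋯ + a_{n+2}x_{n+2}²` on `V = ℚ^{n+2}`. -/
def Qf : QuadraticForm ℚ (Fin (n + 2) → ℚ) :=
  QuadraticMap.weightedSumSquares ℚ (fun i => if (i : ℕ) < 2 then -a i else a i)

/-- The standard basis vectors `eᵢ` of `V`, viewed inside the Clifford algebra `C(V)`. -/
def e (i : Fin (n + 2)) : CliffordAlgebra (Qf n a) := ι (Qf n a) (Pi.single i 1)

/-- The even Clifford algebra `C⁺(V)`. -/
abbrev Cplus : Subalgebra ℚ (CliffordAlgebra (Qf n a)) := even (Qf n a)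

/-- The reversal anti-automorphism `τ`, restricted to the even Clifford algebra. -/
def tau (x : Cplus n a) : Cplus n a :=
  ⟨reverse (Q := Qf n a) (x : CliffordAlgebra (Qf n a)), by
    have hx : (x : CliffordAlgebra (Qf n a)) ∈ evenOdd (Qf n a) 0 := x.2
    exact (reverse_mem_evenOdd_iff (Q := Qf n a)).mpr hx⟩

/-- `tr z` is the trace of the ℚ-linear endomorphism `x ↦ z * x` of `C⁺(V)`. -/
def tr (z : Cplus n a) : ℚ := LinearMap.trace ℚ (Cplus n a) (LinearMap.mulLeft ℚ z)

/-- `λ := e₁e₂ ∈ C⁺(V)`. -/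
def lam : Cplus n a := ⟨e n a 0 * e n a 1, ι_mul_ι_mem_evenOdd_zero (Qf n a) _ _⟩

/-- `λ⁻¹ = -(a₁a₂)⁻¹·λ`. -/
def lamInv : Cplus n a := (-(a 0 * a 1)⁻¹) • lam n a

/-- The coefficients of the form. -/
def qc (i : Fin (n + 2)) : ℚ := if (i : ℕ) < 2 then -a i else a i

lemma e_sq (i : Fin (n + 2)) : e n a i * e n a i = algebraMap ℚ _ (qc n a i) := by
  unfold e
  rw [ι_sq_scalar]
  congr 1
  simp only [Qf, QuadraticMap.weightedSumSquares_apply, qc]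
  rw [Finset.sum_eq_single i]
  · simp
  · intro j _ hj
    simp [Pi.single_apply, hj]
  · simp

lemma e_anti (i j : Fin (n + 2)) (h : i ≠ j) : e n a i * e n a j = - (e n a j * e n a i) := by
  unfold e
  apply ι_mul_ι_comm_of_isOrtho
  rw [QuadraticMap.isOrtho_def]
  simp only [Qf, QuadraticMap.weightedSumSquares_apply]
  rw [← Finset.sum_add_distrib]
  refine Finset.sum_congr rfl fun k _ => ?_
  simp only [Pi.add_apply, Pi.single_apply]
  by_cases h1 : k = i
  · by_cases h2 : k = j
    · exact absurd (h1.symm.trans h2) h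
    · subst h1
      simp [h]
  · simp [h1]

/-- Products of generators. -/
def P (l : List (Fin (n + 2))) : CliffordAlgebra (Qf n a) := (l.map (e n a)).prod

lemma P_nil : P n a [] = 1 := rfl

lemma P_cons (i : Fin (n + 2)) (l) : P n a (i :: l) = e n a i * P n a l := by
  simp [P]

lemma P_append (l l') : P n a (l ++ l') = P n a l * P n a l' := by
  simp [P]

lemma P_perm {l l' : List (Fin (n + 2))} (h : l.Perm l') :
    ∃ c : ℚ, P n a l = c • P n a l' := by
  induction h with
  | nil => exact ⟨1, by simp⟩
  | cons x _ ih =>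
    obtain ⟨c, hc⟩ := ih
    exact ⟨c, by rw [P_cons, P_cons, hc, mul_smul_comm]⟩
  | swap x y l =>
    by_cases h : x = y
    · exact ⟨1, by simp [h]⟩
    · refine ⟨-1, ?_⟩
      simp only [P_cons]
      rw [← mul_assoc, e_anti n a y x (Ne.symm h), ← mul_assoc]
      simp
  | trans _ _ ih1 ih2 =>
    obtain ⟨c, hc⟩ := ih1
    obtain ⟨d, hd⟩ := ih2
    exact ⟨c * d, by rw [hc, hd, mul_smul]⟩

lemma e_P (i : Fin (n + 2)) (l : List (Fin (n + 2))) :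
    e n a i * P n a l = ((-1 : ℚ) ^ (l.length + l.count i)) • (P n a l * e n a i) := by
  induction l with
  | nil => simp [P_nil]
  | cons j l ih =>
    rw [P_cons, ← mul_assoc]
    by_cases h : i = j
    · subst h
      rw [mul_assoc, ih, mul_smul_comm, ← mul_assoc]
      simp only [List.length_cons, List.count_cons_self]
      have : (-1 : ℚ) ^ (l.length + 1 + (l.count i + 1)) = (-1) ^ (l.length + l.count i) := by
        ring
      rw [this, ← ih]
    · rw [e_anti n a i j h, neg_mul, mul_assoc, ih, mul_smul_comm, ← mul_assoc,
        List.length_cons, List.count_cons_of_ne (Ne.symm h), ← neg_smul]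
      congr 1
      ring

lemma P_even (l : List (Fin (n + 2))) : P n a l ∈ evenOdd (Qf n a) (l.length : ZMod 2) := by
  induction l with
  | nil => 
    rw [P_nil]
    simpa using (Submodule.one_le.mp (one_le_evenOdd_zero (Qf n a)))
  | cons j l ih =>
    have h := evenOdd_mul_le (Qf n a) 1 (l.length : ZMod 2)
      (Submodule.mul_mem_mul (ι_mem_evenOdd_one (Qf n a) (Pi.single j 1)) ih)
    rw [P_cons, List.length_cons, Nat.cast_succ, add_comm (l.length : ZMod 2)]
    exact h

lemma P_reverse (l : List (Fin (n + 2))) :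
    reverse (Q := Qf n a) (P n a l) = P n a l.reverse := by
  induction l with
  | nil => simp [P_nil]
  | cons j l ih =>
    rw [P_cons, reverse.map_mul, ih, List.reverse_cons, P_append, P_cons, P_nil, mul_one]
    congr 1
    exact reverse_ι _

lemma lam_e (i : Fin (n + 2)) :
    (e n a 0 * e n a 1) * e n a i
      = (if (i : ℕ) < 2 then (-1 : ℚ) else 1) • (e n a i * (e n a 0 * e n a 1)) := by
  have h01 : (0 : Fin (n + 2)) ≠ 1 := by simp
  by_cases h0 : i = 0
  · subst h0
    rw [mul_assoc, e_anti n a 1 0 h01.symm]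
    simp
  by_cases h1 : i = 1
  · subst h1
    rw [← mul_assoc (e n a 1), e_anti n a 1 0 h01.symm]
    simp
  have : ¬ (i : ℕ) < 2 := by
    intro h
    have h0' : (i : ℕ) ≠ 0 := fun h => h0 (Fin.ext (by simpa using h))
    have h1' : (i : ℕ) ≠ 1 := fun h => h1 (Fin.ext (by simpa using h))
    omega
  rw [if_neg this, one_smul, mul_assoc, e_anti n a 1 i (Ne.symm h1), mul_neg, ← mul_assoc,
    e_anti n a 0 i (Ne.symm h0), neg_mul, neg_neg, mul_assoc]

lemma e_lam_e (i : Fin (n + 2)) :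
    e n a i * (e n a 0 * e n a 1) * e n a i = a i • (e n a 0 * e n a 1) := by
  rw [mul_assoc, lam_e, mul_smul_comm, ← mul_assoc, e_sq, ← Algebra.smul_def, smul_smul]
  congr 1
  unfold qc
  split_ifs <;> simp

lemma P_lam_P (l : List (Fin (n + 2))) :
    P n a l.reverse * (e n a 0 * e n a 1) * P n a l
      = (l.map a).prod • (e n a 0 * e n a 1) := by
  induction l with
  | nil => simp [P_nil]
  | cons j l ih =>
    rw [List.reverse_cons, P_append, P_cons, P_nil, mul_one, P_cons]
    calc _ = P n a l.reverse * (e n a j * (e n a 0 * e n a 1) * e n a j) * P n a l := by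
          simp only [mul_assoc]
      _ = _ := by
          rw [e_lam_e, mul_smul_comm, smul_mul_assoc, ih, smul_smul, List.map_cons,
            List.prod_cons]

lemma lam_lam : (e n a 0 * e n a 1) * (e n a 0 * e n a 1)
    = algebraMap ℚ (CliffordAlgebra (Qf n a)) (-(a 0 * a 1)) := by
  rw [← mul_assoc, mul_assoc (e n a 0), e_anti n a 1 0 (by simp), mul_neg, ← mul_assoc, e_sq,
    neg_mul, mul_assoc, e_sq, ← map_mul, ← map_neg]
  simp [qc]

/-- Span of the monomials of given parity. -/
def W (p : ZMod 2) : Submodule ℚ (CliffordAlgebra (Qf n a)) :=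
  Submodule.span ℚ (Set.range
    fun S : {S : Finset (Fin (n + 2)) // (S.card : ZMod 2) = p} => P n a S.1.toList)

lemma e_mul_W (p : ZMod 2) (i) (x) (hx : x ∈ W n a p) : e n a i * x ∈ W n a (p + 1) := by
  induction hx using Submodule.span_induction with
  | mem x h =>
    obtain ⟨⟨S, hS⟩, rfl⟩ := h
    simp only
    by_cases hi : i ∈ S
    · obtain ⟨c, hc⟩ := P_perm n a (Finset.toList_cons (Finset.notMem_erase i S))
      obtain ⟨c, hc⟩ := P_perm n a (l := S.toList) (l' := i :: (S.erase i).toList) (by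
        have := Finset.toList_cons (Finset.notMem_erase i S)
        rwa [Finset.cons_eq_insert, Finset.insert_erase hi] at this)
      rw [hc, P_cons, mul_smul_comm, ← mul_assoc, e_sq, ← Algebra.smul_def]
      refine Submodule.smul_mem _ _ (Submodule.smul_mem _ _ (Submodule.subset_span
        ⟨⟨S.erase i, ?_⟩, rfl⟩))
      have := Finset.card_erase_add_one hi
      rw [← hS, ← this]
      push_cast
      rw [add_assoc]
      have : (1 + 1 : ZMod 2) = 0 := by decide
      rw [this, add_zero]
    · obtain ⟨c, hc⟩ := P_perm n a (Finset.toList_cons hi).symm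
      rw [← P_cons, hc]
      refine Submodule.smul_mem _ _ (Submodule.subset_span ⟨⟨Finset.cons i S hi, ?_⟩, rfl⟩)
      rw [Finset.card_cons, Nat.cast_succ, hS]
  | zero => simp
  | add x y _ _ hx hy => rw [mul_add]; exact add_mem hx hy
  | smul c x _ hx => rw [mul_smul_comm]; exact Submodule.smul_mem _ _ hx

lemma ι_mul_W (p : ZMod 2) (m) (x) (hx : x ∈ W n a p) : ι (Qf n a) m * x ∈ W n a (p + 1) := by
  have : m = ∑ i, m i • (Pi.single i 1 : Fin (n + 2) → ℚ) := by
    ext j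
    simp [Finset.sum_apply, Pi.single_apply]
  rw [this, map_sum, Finset.sum_mul]
  refine Submodule.sum_mem _ fun i _ => ?_
  rw [map_smul, smul_mul_assoc]
  exact Submodule.smul_mem _ _ (e_mul_W n a p i x hx)

lemma even_le_W (x) (hx : x ∈ evenOdd (Qf n a) 0) : x ∈ W n a 0 := by
  induction x, hx using even_induction with
  | algebraMap r =>
    rw [Algebra.algebraMap_eq_smul_one]
    exact Submodule.smul_mem _ _ (Submodule.subset_span ⟨⟨∅, by simp⟩, by simp [P_nil]⟩)
  | add x y hx hy ihx ihy => exact add_mem ihx ihy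
  | ι_mul_ι_mul m₁ m₂ x hx ih =>
    rw [mul_assoc]
    exact ι_mul_W n a 1 m₁ _ (by simpa using ι_mul_W n a 0 m₂ _ ih)

/-- Index set of even monomials. -/
abbrev Ix := {S : Finset (Fin (n + 2)) // (S.card : ZMod 2) = 0}

/-- Even monomials. -/
def E (S : Ix n) : Cplus n a := ⟨P n a S.1.toList, by
  have := P_even n a S.1.toList
  rw [Finset.length_toList, S.2] at this
  exact this⟩

lemma exists_coeff (x : Cplus n a) : ∃ c : Ix n → ℚ, x = ∑ S, c S • E n a S := by
  have h := even_le_W n a x.1 x.2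
  unfold W at h
  rw [Submodule.mem_span_range_iff_exists_fun] at h
  obtain ⟨c, hc⟩ := h
  refine ⟨c, Subtype.ext ?_⟩
  rw [← hc]
  simp [E]

instance fin_Cplus : Module.Finite ℚ (Cplus n a) := by
  refine Module.Finite.of_surjective (Fintype.linearCombination ℚ (E n a)) fun x => ?_
  obtain ⟨c, hc⟩ := exists_coeff n a x
  exact ⟨c, by rw [hc, Fintype.linearCombination_apply]⟩

/-- Conjugation by a generator, up to a scalar. -/
def conj (i : Fin (n + 2)) : Cplus n a →ₗ[ℚ] Cplus n a :=
  LinearMap.restrict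
    ((LinearMap.mulLeft ℚ (e n a i)).comp (LinearMap.mulRight ℚ (e n a i)))
    (p := Subalgebra.toSubmodule (Cplus n a)) (q := Subalgebra.toSubmodule (Cplus n a)) (by
      intro x hx
      have h1 : e n a i ∈ evenOdd (Qf n a) 1 := ι_mem_evenOdd_one (Qf n a) _
      have h : e n a i * (x * e n a i) ∈ evenOdd (Qf n a) (1 + (0 + 1)) :=
        SetLike.GradedMul.mul_mem h1 (SetLike.GradedMul.mul_mem hx h1)
      exact h)

lemma conj_coe (i) (x : Cplus n a) :
    ((conj n a i x : Cplus n a) : CliffordAlgebra (Qf n a)) = e n a i * (x.1 * e n a i) := rfl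

lemma tr_zero (ha : ∀ i, 0 < a i) (i) (z : Cplus n a)
    (h : e n a i * z.1 = - (z.1 * e n a i)) : tr n a z = 0 := by
  have hq : qc n a i ≠ 0 := by
    have := ha i
    unfold qc
    split_ifs <;> linarith [ha i] <;> simp [this.ne']
  have h1 : conj n a i * conj n a i = (qc n a i * qc n a i) • (1 : Module.End ℚ (Cplus n a)) := by
    ext x
    simp only [Module.End.mul_apply, conj_coe, LinearMap.smul_apply, Module.End.one_apply]
    calc _ = (e n a i * e n a i) * (x.1 * (e n a i * e n a i)) := by simp only [mul_assoc]
      _ = _ := by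
        rw [e_sq, ← Algebra.commutes, ← Algebra.smul_def, ← Algebra.smul_def, smul_smul]
        rfl
  have h2 : conj n a i * LinearMap.mulLeft ℚ z = - (LinearMap.mulLeft ℚ z * conj n a i) := by
    ext x
    simp only [Module.End.mul_apply, conj_coe, LinearMap.neg_apply, LinearMap.mulLeft_apply,
      Subalgebra.coe_mul, Subalgebra.coe_neg]
    rw [← mul_assoc, ← mul_assoc, h]
    simp only [mul_assoc, neg_mul]
  have h3 : LinearMap.trace ℚ (Cplus n a) (LinearMap.mulLeft ℚ z * (conj n a i * conj n a i))
      = - LinearMap.trace ℚ (Cplus n a) (LinearMap.mulLeft ℚ z * (conj n a i * conj n a i)) := by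
    conv_lhs => rw [← mul_assoc, LinearMap.trace_mul_comm, ← mul_assoc, h2]
    rw [← map_neg]
    congr 1
  rw [h1, mul_smul_comm, mul_one, map_smul, smul_eq_mul] at h3
  have h4 : (qc n a i * qc n a i) * LinearMap.trace ℚ (Cplus n a) (LinearMap.mulLeft ℚ z) = 0 := by
    linarith
  exact (mul_eq_zero.mp h4).resolve_left (mul_ne_zero hq hq)

lemma tr_one_pos : 0 < tr n a 1 := by
  unfold tr
  rw [LinearMap.mulLeft_one]
  have := LinearMap.trace_id ℚ (Cplus n a)
  rw [this]
  exact_mod_cast Module.finrank_pos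

/-- The bilinear form of the statement. -/
def B : Cplus n a →ₗ[ℚ] Cplus n a →ₗ[ℚ] ℚ :=
  LinearMap.mk₂ ℚ (fun x y => tr n a (lamInv n a * tau n a x * lam n a * y))
    (by
      intro x y z
      have : tau n a (x + y) = tau n a x + tau n a y := Subtype.ext (by simp [tau])
      rw [this]
      simp only [tr, mul_add, add_mul, ← map_add]
      congr 1
      ext w
      simp [add_mul, mul_assoc])
    (by
      intro c x y
      have : tau n a (c • x) = c • tau n a x := Subtype.ext (by simp [tau])
      rw [this]
      simp only [tr, mul_smul_comm, smul_mul_assoc, ← map_smul]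
      congr 1
      ext w
      simp [mul_assoc])
    (by
      intro x y z
      simp only [tr, mul_add, ← map_add]
      congr 1
      ext w
      simp [add_mul, mul_assoc])
    (by
      intro c x y
      simp only [tr, mul_smul_comm, ← map_smul]
      congr 1
      ext w
      simp [mul_assoc])

lemma B_apply (x y) : B n a x y = tr n a (lamInv n a * tau n a x * lam n a * y) := rfl

lemma B_E_self (ha : ∀ i, 0 < a i) (S : Ix n) :
    B n a (E n a S) (E n a S) = (S.1.toList.map a).prod * tr n a 1 := by
  have h : lamInv n a * tau n a (E n a S) * lam n a * E n a S
      = (S.1.toList.map a).prod • (1 : Cplus n a) := by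
    apply Subtype.ext
    have h0 : (a 0 * a 1) ≠ 0 := (mul_pos (ha 0) (ha 1)).ne'
    simp only [lamInv, tau, lam, E, Subalgebra.coe_mul, Subalgebra.coe_smul, P_reverse,
      Subalgebra.coe_one]
    rw [mul_assoc, mul_assoc, ← mul_assoc (P n a _), P_lam_P, mul_smul_comm, smul_mul_assoc,
      lam_lam, ← Algebra.algebraMap_eq_smul_one, Algebra.smul_def, Algebra.smul_def, ← map_mul,
      ← map_mul]
    congr 1
    rw [mul_comm (List.prod _), neg_mul_neg, inv_mul_cancel₀ h0, one_mul]
  rw [B_apply, h]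
  unfold tr
  rw [← smul_eq_mul, ← map_smul]
  congr 1
  ext w
  simp

lemma B_E_ne (ha : ∀ i, 0 < a i) (S T : Ix n) (hST : S ≠ T) :
    B n a (E n a S) (E n a T) = 0 := by
  rw [B_apply]
  obtain ⟨i, hi⟩ : ∃ i, ¬ (i ∈ S.1 ↔ i ∈ T.1) := by
    by_contra hcon
    push Not at hcon
    exact hST (Subtype.ext (Finset.ext hcon))
  refine tr_zero n a ha i _ ?_
  have key : (lamInv n a * tau n a (E n a S) * lam n a * E n a T : Cplus n a).1
      = (-(a 0 * a 1)⁻¹) • P n a ([0, 1] ++ (S.1.toList.reverse ++ ([0, 1] ++ T.1.toList))) := by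
    simp only [lamInv, tau, lam, E, Subalgebra.coe_mul, Subalgebra.coe_smul, P_reverse,
      P_append, P_cons, P_nil, mul_one, smul_mul_assoc, mul_assoc]
  rw [key, mul_smul_comm, e_P, smul_mul_assoc, ← smul_neg]
  congr 1
  have hS : Even S.1.card := (ZMod.natCast_eq_zero_iff_even).mp S.2
  have hT : Even T.1.card := (ZMod.natCast_eq_zero_iff_even).mp T.2
  have hodd : Odd (([0, 1] ++ (S.1.toList.reverse ++ ([0, 1] ++ T.1.toList))).length +
      ([0, 1] ++ (S.1.toList.reverse ++ ([0, 1] ++ T.1.toList))).count i) := by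
    have c1 : ∀ U : Finset (Fin (n + 2)), U.toList.count i = if i ∈ U then 1 else 0 := by
      intro U
      rw [U.nodup_toList.count]
      simp
    rw [List.count_append, List.count_append, List.count_append, List.count_reverse, c1, c1]
    simp only [List.length_append, List.length_reverse, Finset.length_toList]
    generalize List.count i [0, 1] = k
    have : (if i ∈ S.1 then 1 else 0) + (if i ∈ T.1 then 1 else 0) = 1 := by
      by_cases h1 : i ∈ S.1 <;> by_cases h2 : i ∈ T.1 <;> simp_all
    obtain ⟨s, hs⟩ := hS
    obtain ⟨t, ht⟩ := hT
    refine ⟨s + t + 2 + k, ?_⟩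
    simp only [List.length_cons, List.length_nil]
    omega
  rw [hodd.neg_one_pow, neg_one_smul]

lemma B_sum (ha : ∀ i, 0 < a i) (c d : Ix n → ℚ) :
    B n a (∑ S, c S • E n a S) (∑ S, d S • E n a S)
      = ∑ S, c S * d S * ((S.1.toList.map a).prod * tr n a 1) := by
  simp only [map_sum, LinearMap.sum_apply, map_smul, LinearMap.smul_apply, smul_eq_mul]
  refine Finset.sum_congr rfl fun S _ => ?_
  rw [Finset.sum_eq_single S]
  · rw [B_E_self n a ha]
    ring
  · intro T _ hT
    rw [B_E_ne n a ha T S hT]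
    simp
  · simp

/-- The map `x ↦ λ⁻¹τ(x)λ` is a positive involution on `C⁺(V)`: the form
`(x, y) ↦ tr(λ⁻¹·τ(x)·λ·y)` is symmetric and positive definite. -/
theorem statement0 (hn : 1 ≤ n) (ha : ∀ i, 0 < a i) :
    (∀ x y : Cplus n a,
        tr n a (lamInv n a * tau n a x * lam n a * y)
          = tr n a (lamInv n a * tau n a y * lam n a * x)) ∧
    (∀ x : Cplus n a, x ≠ 0 →
        0 < tr n a (lamInv n a * tau n a x * lam n a * x)) := by
  constructor
  · intro x y
    obtain ⟨c, rfl⟩ := exists_coeff n a x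
    obtain ⟨d, rfl⟩ := exists_coeff n a y
    rw [← B_apply, ← B_apply, B_sum n a ha, B_sum n a ha]
    refine Finset.sum_congr rfl fun S _ => ?_
    ring
  · intro x hx
    obtain ⟨c, rfl⟩ := exists_coeff n a x
    rw [← B_apply, B_sum n a ha]
    have hpos : ∀ S : Ix n, 0 < (S.1.toList.map a).prod * tr n a 1 := fun S =>
      mul_pos (List.prod_pos (by
        intro b hb
        obtain ⟨i, _, rfl⟩ := List.mem_map.mp hb
        exact ha i)) (tr_one_pos n a)
    obtain ⟨S, hS⟩ : ∃ S, c S ≠ 0 := by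
      by_contra hcon
      push Not at hcon
      exact hx (by simp [hcon])
    exact Finset.sum_pos' (fun T _ => mul_nonneg (mul_self_nonneg _) (hpos T).le)
      ⟨S, Finset.mem_univ _, mul_pos (mul_self_pos.mpr hS) (hpos S)⟩
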